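/- The limit of the parametrized Q-functions recovers the unconstrained value function: for every (x, u, t) ∈ ℝ^n × ℝ^m × [0,T], Q⁰(x, u, t) := lim_{ε→0⁺} Q^ε(x, u, t) = v(x, t), where v(x, t) := inf over all measurable controls u : [t,T] → ℝ^m with x(t) = x of ∫_t^T r(x(s), u(s)) ds + q(x(T)). -/

import Mathlib

open MeasureTheory Set

noncomputable section

/-- Carathéodory solution of `ẋ(s) = f(x(s), u(s))` on `[t, T]`:
`x s = x t + ∫_t^s f(x(τ), u(τ)) dτ` (with the integrand interval integrable). -/
def IsTrajectory {n m : ℕ}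
    (f : EuclideanSpace ℝ (Fin n) → EuclideanSpace ℝ (Fin m) → EuclideanSpace ℝ (Fin n))
    (t T : ℝ) (x : ℝ → EuclideanSpace ℝ (Fin n)) (u : ℝ → EuclideanSpace ℝ (Fin m)) : Prop :=
  ∀ s ∈ Set.Icc t T,
    IntervalIntegrable (fun τ => f (x τ) (u τ)) MeasureTheory.volume t s ∧
      x s = x t + ∫ τ in t..s, f (x τ) (u τ)

/-- The total cost `∫_t^T r(x(s), u(s)) ds + q(x(T))`. -/
def cost {n m : ℕ}
    (r : EuclideanSpace ℝ (Fin n) → EuclideanSpace ℝ (Fin m) → ℝ)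
    (q : EuclideanSpace ℝ (Fin n) → ℝ) (t T : ℝ)
    (x : ℝ → EuclideanSpace ℝ (Fin n)) (u : ℝ → EuclideanSpace ℝ (Fin m)) : ℝ :=
  (∫ s in t..T, r (x s) (u s)) + q (x T)

/-- Admissible controls `𝕌₁`: Lipschitz continuous on `[0, T]` with
Lipschitz constant (equivalently, `‖u̇‖_{L^∞}` bound) `M`. -/
def Adm {m : ℕ} (M T : ℝ) (u : ℝ → EuclideanSpace ℝ (Fin m)) : Prop :=
  LipschitzOnWith (Real.toNNReal M) u (Set.Icc 0 T)

/-- The ε-parametrized Q-function, over controls Lipschitz with constant `1/ε` on `[0,T]`: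
`Q^ε(x₀,u₀,t) = inf { ∫_t^T r(x(s),u(s)) ds + q(x(T)) : u ∈ 𝕌₁^ε, x(t)=x₀, u(t)=u₀ }`. -/
def Qeps {n m : ℕ}
    (f : EuclideanSpace ℝ (Fin n) → EuclideanSpace ℝ (Fin m) → EuclideanSpace ℝ (Fin n))
    (r : EuclideanSpace ℝ (Fin n) → EuclideanSpace ℝ (Fin m) → ℝ)
    (q : EuclideanSpace ℝ (Fin n) → ℝ) (T ε : ℝ)
    (x₀ : EuclideanSpace ℝ (Fin n)) (u₀ : EuclideanSpace ℝ (Fin m)) (t : ℝ) : ℝ :=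
  sInf { c : ℝ | ∃ x u, Adm (1 / ε) T u ∧ IsTrajectory f t T x u ∧
      x t = x₀ ∧ u t = u₀ ∧ c = cost r q t T x u }

open Filter Topology

/-- The optimal value function over all measurable controls:
`v(x₀,t) = inf { ∫_t^T r(x(s),u(s)) ds + q(x(T)) : u measurable, x(t) = x₀ }`. -/
def vfun {n m : ℕ}
    (f : EuclideanSpace ℝ (Fin n) → EuclideanSpace ℝ (Fin m) → EuclideanSpace ℝ (Fin n))
    (r : EuclideanSpace ℝ (Fin n) → EuclideanSpace ℝ (Fin m) → ℝ)
    (q : EuclideanSpace ℝ (Fin n) → ℝ) (T : ℝ)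
    (x₀ : EuclideanSpace ℝ (Fin n)) (t : ℝ) : ℝ :=
  sInf { c : ℝ | ∃ (x : ℝ → EuclideanSpace ℝ (Fin n)) (u : ℝ → EuclideanSpace ℝ (Fin m)),
      Measurable u ∧ IsTrajectory f t T x u ∧ x t = x₀ ∧ c = cost r q t T x u }

/-- The truncated distance between two measurable functions is integrable on bounded intervals. -/
theorem intervalIntegrable_min_one_norm_sub {E : Type*} [NormedAddCommGroup E]
    [NormedSpace ℝ E] [FiniteDimensional ℝ E] [MeasurableSpace E] [BorelSpace E]
    {u w : ℝ → E} (hu : Measurable u) (hw : Measurable w) (a b : ℝ) :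
    IntervalIntegrable (fun s => min 1 ‖u s - w s‖) volume a b := by
  refine (intervalIntegrable_const (c := (1 : ℝ))).mono_fun
    (measurable_const.min (hu.sub hw).norm).aestronglyMeasurable (.of_forall fun s => ?_)
  simp [abs_of_nonneg]

/-- Measurable controls can be approximated by Lipschitz ones with a prescribed initial value, in
the metric of convergence in measure. -/
theorem exists_lipschitzWith_integral_min_one_norm_sub_le {E : Type*} [NormedAddCommGroup E]
    [NormedSpace ℝ E] [FiniteDimensional ℝ E] [MeasurableSpace E] [BorelSpace E]
    {u : ℝ → E} (hu : Measurable u) {a b : ℝ} (hab : a ≤ b) (u₀ : E) {η : ℝ} (hη : 0 < η) :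
    ∃ (C : NNReal) (w : ℝ → E), LipschitzWith C w ∧ w a = u₀ ∧
      ∫ s in a..b, min 1 ‖u s - w s‖ ≤ η := by
  have hη3 : 0 < η / 3 := by positivity
  obtain ⟨k, hk⟩ : ∃ k : ℕ,
      ∫ s in a..b, min 1 ‖u s - {s | ‖u s‖ ≤ (k : ℝ)}.indicator u s‖ < η / 3 := by
    have hlim : Tendsto (fun k : ℕ => ∫ s in a..b,
        min 1 ‖u s - {s | ‖u s‖ ≤ (k : ℝ)}.indicator u s‖) atTop (𝓝 (∫ _s in a..b, (0 : ℝ))) := by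
      refine intervalIntegral.tendsto_integral_filter_of_dominated_convergence (fun _ => 1)
        (.of_forall fun k => ?_) (.of_forall fun k => ?_) (by simp) (.of_forall fun s _ => ?_)
      · have : Measurable ({s | ‖u s‖ ≤ (k : ℝ)}.indicator u) :=
          hu.indicator (measurableSet_le hu.norm measurable_const)
        exact (measurable_const.min (hu.sub this).norm).aestronglyMeasurable
      · refine .of_forall fun s _ => ?_
        rw [Real.norm_of_nonneg (by positivity)]
        exact min_le_left _ _
      · refine tendsto_const_nhds.congr' ?_
        obtain ⟨N, hN⟩ := exists_nat_ge ‖u s‖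
        filter_upwards [eventually_ge_atTop N] with k hk
        have : s ∈ {s | ‖u s‖ ≤ (k : ℝ)} := hN.trans (by exact_mod_cast hk)
        simp [Set.indicator_of_mem this]
    rw [intervalIntegral.integral_zero] at hlim
    exact (hlim.eventually (gt_mem_nhds hη3)).exists
  set v := {s | ‖u s‖ ≤ (k : ℝ)}.indicator u with hv
  have hvm : Measurable v := hu.indicator (measurableSet_le hu.norm measurable_const)
  have hvb : ∀ s, ‖v s‖ ≤ k := fun s => by
    by_cases h : s ∈ {s | ‖u s‖ ≤ (k : ℝ)}
    · simpa [hv, Set.indicator_of_mem h] using h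
    · simp [hv, Set.indicator_of_notMem h]
  have hvL : MemLp v 1 (volume.restrict (Ioc a b)) :=
    MemLp.of_bound hvm.aestronglyMeasurable k (.of_forall hvb)
  obtain ⟨g, hgc, hgs, hg⟩ := hvL.exist_eLpNorm_sub_le ENNReal.one_ne_top le_rfl hη3
  obtain ⟨C, hC⟩ := ContDiff.lipschitzWith_of_hasCompactSupport hgc hgs (by simp)
  have hvg : IntervalIntegrable (fun s => ‖v s - g s‖) volume a b := by
    rw [intervalIntegrable_iff_integrableOn_Ioc_of_le hab]
    refine ((memLp_one_iff_integrable.1 hvL).sub ?_).norm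
    exact (hgs.continuous.integrable_of_hasCompactSupport hgc).restrict
  have hg' : ∫ s in a..b, ‖v s - g s‖ ≤ η / 3 := by
    rw [intervalIntegral.integral_of_le hab]
    change ∫ s in Ioc a b, ‖(v - g) s‖ ≤ _
    rw [integral_norm_eq_lintegral_enorm
      (hvm.aestronglyMeasurable.sub hgs.continuous.aestronglyMeasurable)]
    rw [eLpNorm_one_eq_lintegral_enorm] at hg
    exact ENNReal.toReal_le_of_le_ofReal hη3.le hg
  obtain ⟨j, hj⟩ : ∃ j : ℕ, ∫ s in a..b, max 0 (1 - j * |s - a|) * ‖u₀ - g a‖ < η / 3 := by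
    have hlim : Tendsto (fun j : ℕ => ∫ s in a..b, max 0 (1 - j * |s - a|) * ‖u₀ - g a‖) atTop
        (𝓝 (∫ _s in a..b, (0 : ℝ))) := by
      refine intervalIntegral.tendsto_integral_filter_of_dominated_convergence
        (fun _ => ‖u₀ - g a‖)
        (.of_forall fun k => ?_) (.of_forall fun k => ?_) (by simp) (.of_forall fun s hs => ?_)
      · exact (by fun_prop : Continuous _).aestronglyMeasurable
      · refine .of_forall fun s _ => ?_
        rw [Real.norm_of_nonneg (by positivity)]
        refine mul_le_of_le_one_left (norm_nonneg _) (max_le zero_le_one ?_)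
        have : 0 ≤ (k : ℝ) * |s - a| := by positivity
        linarith
      · refine tendsto_const_nhds.congr' ?_
        rw [uIoc_of_le hab] at hs
        have hpos : 0 < |s - a| := abs_pos.2 (sub_ne_zero.2 hs.1.ne')
        obtain ⟨N, hN⟩ := exists_nat_ge (1 / |s - a|)
        filter_upwards [eventually_ge_atTop N] with k hk
        have h1 : 1 / |s - a| ≤ (k : ℝ) := hN.trans (by exact_mod_cast hk)
        rw [div_le_iff₀ hpos] at h1
        rw [max_eq_left (by linarith), zero_mul]
    rw [intervalIntegral.integral_zero] at hlim
    exact (hlim.eventually (gt_mem_nhds hη3)).exists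
  have hwl : LipschitzWith (C + j * ‖u₀ - g a‖₊)
      (fun s => g s + max 0 (1 - j * |s - a|) • (u₀ - g a)) := by
    refine hC.add (LipschitzWith.of_dist_le_mul fun x y => ?_)
    rw [dist_eq_norm, ← sub_smul, norm_smul, Real.dist_eq, Real.norm_eq_abs, NNReal.coe_mul,
      NNReal.coe_natCast, coe_nnnorm, mul_right_comm]
    refine mul_le_mul_of_nonneg_right ?_ (norm_nonneg _)
    rw [max_comm 0, max_comm 0]
    refine (abs_max_sub_max_le_abs _ _ _).trans ?_
    rw [sub_sub_sub_cancel_left, ← mul_sub, abs_mul, Nat.abs_cast]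
    refine mul_le_mul_of_nonneg_left ?_ (Nat.cast_nonneg _)
    calc |(|y - a| - |x - a|)| ≤ |(y - a) - (x - a)| := abs_abs_sub_abs_le _ _
      _ = |x - y| := by rw [sub_sub_sub_cancel_right, abs_sub_comm]
  refine ⟨_, _, hwl, by simp, ?_⟩
  have hI1 : IntervalIntegrable (fun s => min 1 ‖u s - v s‖) volume a b :=
    intervalIntegrable_min_one_norm_sub hu hvm a b
  have hI3 : IntervalIntegrable (fun s => max 0 (1 - j * |s - a|) * ‖u₀ - g a‖) volume a b :=
    (by fun_prop : Continuous _).intervalIntegrable _ _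
  calc ∫ s in a..b, min 1 ‖u s - (g s + max 0 (1 - j * |s - a|) • (u₀ - g a))‖
      ≤ ∫ s in a..b, ((min 1 ‖u s - v s‖ + ‖v s - g s‖) + max 0 (1 - j * |s - a|) * ‖u₀ - g a‖) := by
        refine intervalIntegral.integral_mono_on hab
          (intervalIntegrable_min_one_norm_sub hu hwl.continuous.measurable a b)
          ((hI1.add hvg).add hI3) fun s _ => ?_
        have h1 : ‖u s - (g s + max 0 (1 - j * |s - a|) • (u₀ - g a))‖ ≤
            ‖u s - v s‖ + ‖v s - g s‖ + max 0 (1 - j * |s - a|) * ‖u₀ - g a‖ := by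
          have h2 : ‖max 0 (1 - j * |s - a|) • (u₀ - g a)‖ =
              max 0 (1 - j * |s - a|) * ‖u₀ - g a‖ := by
            rw [norm_smul, Real.norm_of_nonneg (le_max_left _ _)]
          rw [← h2]
          calc _ = ‖(u s - v s) + (v s - g s) - max 0 (1 - j * |s - a|) • (u₀ - g a)‖ := by
                congr 1; abel
            _ ≤ _ := (norm_sub_le _ _).trans (by gcongr; exact norm_add_le _ _)
        have h3 : 0 ≤ max 0 (1 - j * |s - a|) * ‖u₀ - g a‖ := by positivity
        have h4 := norm_nonneg (v s - g s)
        rcases le_total 1 ‖u s - v s‖ with h | h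
        · rw [min_eq_left h]
          exact (min_le_left _ _).trans (by linarith)
        · rw [min_eq_right h]
          exact (min_le_right _ _).trans h1
    _ ≤ η / 3 + η / 3 + η / 3 := by
        rw [intervalIntegral.integral_add (hI1.add hvg) hI3, intervalIntegral.integral_add hI1 hvg]
        gcongr
    _ = η := by ring

/-- Integral form of Grönwall's inequality. -/
theorem le_mul_exp_of_le_integral {φ : ℝ → ℝ} {a b K η : ℝ} (hK : 0 < K)
    (hφ : ContinuousOn φ (Icc a b)) (h0 : ∀ s ∈ Icc a b, 0 ≤ φ s)
    (h : ∀ s ∈ Icc a b, φ s ≤ K * (∫ τ in a..s, φ τ) + η) :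
    ∀ s ∈ Icc a b, φ s ≤ η * Real.exp (K * (s - a)) := by
  intro s hs
  have hab : a ≤ b := hs.1.trans hs.2
  have hint : ∀ x ∈ Icc a b, IntervalIntegrable φ volume a x := fun x hx =>
    (hφ.mono (by rw [uIcc_of_le hx.1]; exact Icc_subset_Icc_right hx.2)).intervalIntegrable
  have hnn : ∀ x ∈ Icc a b, 0 ≤ ∫ τ in a..x, φ τ := fun x hx =>
    intervalIntegral.integral_nonneg hx.1 fun τ hτ => h0 τ ⟨hτ.1, hτ.2.trans hx.2⟩
  have key := norm_le_gronwallBound_of_norm_deriv_right_le (f := fun x => ∫ τ in a..x, φ τ)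
    (f' := φ) (δ := 0) (K := K) (ε := η) (a := a) (b := b) ?_ ?_ (by simp) ?_ s hs
  · rw [Real.norm_of_nonneg (hnn s hs), gronwallBound_of_K_ne_0 hK.ne'] at key
    calc φ s ≤ K * (∫ τ in a..s, φ τ) + η := h s hs
      _ ≤ K * (0 * Real.exp (K * (s - a)) + η / K * (Real.exp (K * (s - a)) - 1)) + η := by gcongr
      _ = η * Real.exp (K * (s - a)) := by field_simp; ring
  · have := intervalIntegral.continuousOn_primitive_interval' (hint b ⟨hab, le_rfl⟩)
      (left_mem_uIcc)
    rwa [uIcc_of_le hab] at this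
  · intro x hx
    have hx' : x ∈ Icc a b := ⟨hx.1, hx.2.le⟩
    have hmem : Icc a b ∈ 𝓝[>] x :=
      mem_of_superset (Ioo_mem_nhdsGT hx.2) fun y hy => ⟨hx.1.trans hy.1.le, hy.2.le⟩
    refine intervalIntegral.integral_hasDerivWithinAt_right (t := Ioi x) (hint x hx') ?_ ?_
    · exact ⟨Icc a b, hmem, hφ.aestronglyMeasurable measurableSet_Icc⟩
    · exact (hφ x hx').mono_of_mem_nhdsWithin hmem
  · intro x hx
    have hx' : x ∈ Icc a b := ⟨hx.1, hx.2.le⟩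
    rw [Real.norm_of_nonneg (h0 x hx'), Real.norm_of_nonneg (hnn x hx')]
    exact h x hx'

/-- A bounded Lipschitz function of two variables depends on the second one through the truncated
distance. -/
theorem norm_sub_le_add_min_one {X U G : Type*} [SeminormedAddCommGroup X]
    [SeminormedAddCommGroup U] [SeminormedAddCommGroup G] {F : X → U → G} {C : ℝ} {K : NNReal}
    (hb : ∀ x u, ‖F x u‖ ≤ C) (hl : LipschitzWith K (fun p : X × U => F p.1 p.2))
    (x y : X) (u w : U) :
    ‖F x u - F y w‖ ≤ K * ‖x - y‖ + (K + 2 * C) * min 1 ‖u - w‖ := by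
  have hC : 0 ≤ C := (norm_nonneg _).trans (hb x u)
  have h1 : ‖F x u - F y u‖ ≤ K * ‖x - y‖ := by
    simpa [dist_eq_norm, Prod.dist_eq] using hl.dist_le_mul (x, u) (y, u)
  have h2 : ‖F y u - F y w‖ ≤ K * ‖u - w‖ := by
    simpa [dist_eq_norm, Prod.dist_eq] using hl.dist_le_mul (y, u) (y, w)
  have h3 : ‖F y u - F y w‖ ≤ 2 * C := (norm_sub_le _ _).trans (by linarith [hb y u, hb y w])
  have h4 : ‖F y u - F y w‖ ≤ (K + 2 * C) * min 1 ‖u - w‖ := by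
    have := K.coe_nonneg
    rcases le_total 1 ‖u - w‖ with h | h
    · rw [min_eq_left h]; linarith
    · rw [min_eq_right h]
      nlinarith [norm_nonneg (u - w)]
  calc _ = ‖(F x u - F y u) + (F y u - F y w)‖ := by congr 1; abel
    _ ≤ _ := (norm_add_le _ _).trans (add_le_add h1 h4)

section Trajectories

variable {n m : ℕ}
  {f : EuclideanSpace ℝ (Fin n) → EuclideanSpace ℝ (Fin m) → EuclideanSpace ℝ (Fin n)}
  {r : EuclideanSpace ℝ (Fin n) → EuclideanSpace ℝ (Fin m) → ℝ}
  {q : EuclideanSpace ℝ (Fin n) → ℝ} {t T : ℝ}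
  {x y : ℝ → EuclideanSpace ℝ (Fin n)} {u w : ℝ → EuclideanSpace ℝ (Fin m)}

theorem IsTrajectory.congr_control (h : IsTrajectory f t T x u) (huw : EqOn u w (Icc t T)) :
    IsTrajectory f t T x w := by
  intro s hs
  have heq : ∀ τ ∈ uIcc t s, f (x τ) (u τ) = f (x τ) (w τ) := fun τ hτ => by
    rw [uIcc_of_le hs.1] at hτ
    rw [huw ⟨hτ.1, hτ.2.trans hs.2⟩]
  refine ⟨(h s hs).1.congr fun τ hτ => heq τ (uIoc_subset_uIcc hτ), ?_⟩
  rw [(h s hs).2, intervalIntegral.integral_congr heq]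

theorem cost_congr_control (htT : t ≤ T) (huw : EqOn u w (Icc t T)) :
    cost r q t T x u = cost r q t T x w := by
  unfold cost
  congr 1
  refine intervalIntegral.integral_congr fun τ hτ => ?_
  rw [uIcc_of_le htT] at hτ
  simp only [huw hτ]

theorem IsTrajectory.continuousOn (h : IsTrajectory f t T x u) (htT : t ≤ T) :
    ContinuousOn x (Icc t T) := by
  have := intervalIntegral.continuousOn_primitive_interval' (h T ⟨htT, le_rfl⟩).1 left_mem_uIcc
  rw [uIcc_of_le htT] at this
  exact (continuousOn_const.add this).congr fun s hs => (h s hs).2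

/-- A bounded Lipschitz vector field driven by a continuous control has a trajectory from every
initial point. -/
theorem exists_isTrajectory {C : ℝ} (hb : ∀ x u, ‖f x u‖ ≤ C) {K : NNReal}
    (hl : LipschitzWith K
      (fun p : EuclideanSpace ℝ (Fin n) × EuclideanSpace ℝ (Fin m) => f p.1 p.2))
    (htT : t ≤ T) (hw : Continuous w) (x₀ : EuclideanSpace ℝ (Fin n)) :
    ∃ x, x t = x₀ ∧ IsTrajectory f t T x w := by
  have hC : 0 ≤ C := (norm_nonneg _).trans (hb x₀ 0)
  have hpl : IsPicardLindelof (fun s z => f z (w s)) (⟨t, le_rfl, htT⟩ : Icc t T) x₀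
      (C.toNNReal * (T - t).toNNReal) 0 C.toNNReal K :=
    { lipschitzOnWith := fun s _ => by
        have := hl.comp (LipschitzWith.prodMk_right (w s))
        rw [mul_one] at this
        exact this.lipschitzOnWith
      continuousOn := fun z _ =>
        (hl.continuous.comp (continuous_const.prodMk hw)).continuousOn
      norm_le := fun s _ z _ => by
        rw [Real.coe_toNNReal _ hC]
        exact hb _ _
      mul_max_le := by simp [htT] }
  obtain ⟨x, hx0, hx⟩ := hpl.exists_eq_forall_mem_Icc_hasDerivWithinAt
    (Metric.mem_closedBall_self le_rfl)
  have hxc : ContinuousOn x (Icc t T) := fun s hs => (hx s hs).continuousWithinAt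
  have hfc : ContinuousOn (fun s => f (x s) (w s)) (Icc t T) :=
    hl.continuous.comp_continuousOn (hxc.prodMk hw.continuousOn)
  refine ⟨x, hx0, fun s hs => ?_⟩
  have hsub : Icc t s ⊆ Icc t T := Icc_subset_Icc_right hs.2
  have hint : IntervalIntegrable (fun τ => f (x τ) (w τ)) volume t s :=
    (hfc.mono (by rwa [uIcc_of_le hs.1])).intervalIntegrable
  refine ⟨hint, ?_⟩
  rw [intervalIntegral.integral_eq_sub_of_hasDeriv_right_of_le hs.1 (hxc.mono hsub)
    (fun τ hτ => ?_) hint, add_sub_cancel]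
  have hτ' : τ ∈ Icc t T := hsub ⟨hτ.1.le, hτ.2.le⟩
  exact (hx τ hτ').mono_of_mem_nhdsWithin (mem_of_superset (Ioo_mem_nhdsGT (hτ.2.trans_le hs.2))
    fun z hz => ⟨hτ'.1.trans hz.1.le, hz.2.le⟩)

/-- Two integrals of a bounded Lipschitz function along two state-control pairs are close when
the states are close and the controls are close in measure. -/
theorem norm_integral_sub_integral_le {G : Type*} [NormedAddCommGroup G] [NormedSpace ℝ G]
    {F : EuclideanSpace ℝ (Fin n) → EuclideanSpace ℝ (Fin m) → G} {C : ℝ} {K : NNReal}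
    (hb : ∀ x u, ‖F x u‖ ≤ C)
    (hl : LipschitzWith K
      (fun p : EuclideanSpace ℝ (Fin n) × EuclideanSpace ℝ (Fin m) => F p.1 p.2))
    {s : ℝ} (hs : t ≤ s) (hx : ContinuousOn x (Icc t s)) (hy : ContinuousOn y (Icc t s))
    (hu : Measurable u) (hw : Measurable w)
    (hxi : IntervalIntegrable (fun τ => F (x τ) (u τ)) volume t s)
    (hyi : IntervalIntegrable (fun τ => F (y τ) (w τ)) volume t s) :
    ‖(∫ τ in t..s, F (x τ) (u τ)) - ∫ τ in t..s, F (y τ) (w τ)‖ ≤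
      K * (∫ τ in t..s, ‖x τ - y τ‖) + (K + 2 * C) * ∫ τ in t..s, min 1 ‖u τ - w τ‖ := by
  have h1 : IntervalIntegrable (fun τ => ‖x τ - y τ‖) volume t s := by
    refine ContinuousOn.intervalIntegrable ?_
    rw [uIcc_of_le hs]
    exact (hx.sub hy).norm
  have h2 := intervalIntegrable_min_one_norm_sub hu hw t s
  rw [← intervalIntegral.integral_sub hxi hyi, ← intervalIntegral.integral_const_mul,
    ← intervalIntegral.integral_const_mul,
    ← intervalIntegral.integral_add (h1.const_mul _) (h2.const_mul _)]
  exact intervalIntegral.norm_integral_le_of_norm_le hs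
    (.of_forall fun τ _ => norm_sub_le_add_min_one hb hl _ _ _ _)
    ((h1.const_mul _).add (h2.const_mul _))

/-- A bounded running cost is integrable along trajectories. -/
theorem intervalIntegrable_running_cost {C : ℝ} (hb : ∀ x u, |r x u| ≤ C)
    (hr : Continuous (fun p : EuclideanSpace ℝ (Fin n) × EuclideanSpace ℝ (Fin m) => r p.1 p.2))
    (htT : t ≤ T) (hx : ContinuousOn x (Icc t T)) (hu : Measurable u) :
    IntervalIntegrable (fun τ => r (x τ) (u τ)) volume t T := by
  refine (intervalIntegrable_const (c := C)).mono_fun ?_ (.of_forall fun s => ?_)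
  · rw [uIoc_of_le htT]
    exact hr.comp_aestronglyMeasurable
      (((hx.mono Ioc_subset_Icc_self).aestronglyMeasurable measurableSet_Ioc).prodMk
        hu.aestronglyMeasurable)
  · exact (hb _ _).trans (le_abs_self C)

/-- Trajectories depend on the control continuously with respect to convergence in measure. -/
theorem IsTrajectory.norm_sub_le {C : ℝ} (hb : ∀ x u, ‖f x u‖ ≤ C) {K : NNReal}
    (hl : LipschitzWith K
      (fun p : EuclideanSpace ℝ (Fin n) × EuclideanSpace ℝ (Fin m) => f p.1 p.2))
    (htT : t ≤ T) (hx : IsTrajectory f t T x u) (hy : IsTrajectory f t T y w) (hxy : x t = y t)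
    (hu : Measurable u) (hw : Measurable w) :
    ∀ s ∈ Icc t T, ‖x s - y s‖ ≤
      (K + 2 * C) * Real.exp ((K + 1) * (T - t)) * ∫ τ in t..T, min 1 ‖u τ - w τ‖ := by
  have hC : 0 ≤ C := (norm_nonneg _).trans (hb 0 0)
  have hxc := hx.continuousOn htT
  have hyc := hy.continuousOn htT
  have hI : 0 ≤ ∫ τ in t..T, min 1 ‖u τ - w τ‖ :=
    intervalIntegral.integral_nonneg htT fun _ _ => by positivity
  intro s hs
  refine (le_mul_exp_of_le_integral (φ := fun s => ‖x s - y s‖) (K := K + 1)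
    (η := (K + 2 * C) * ∫ τ in t..T, min 1 ‖u τ - w τ‖) (by positivity) (hxc.sub hyc).norm
    (fun _ _ => norm_nonneg _) (fun s hs => ?_) s hs).trans ?_
  · have hsub : Icc t s ⊆ Icc t T := Icc_subset_Icc_right hs.2
    have h0 : 0 ≤ ∫ τ in t..s, ‖x τ - y τ‖ :=
      intervalIntegral.integral_nonneg hs.1 fun _ _ => norm_nonneg _
    have h1 : ∫ τ in t..s, min 1 ‖u τ - w τ‖ ≤ ∫ τ in t..T, min 1 ‖u τ - w τ‖ :=
      intervalIntegral.integral_mono_interval le_rfl hs.1 hs.2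
        (.of_forall fun _ => by positivity) (intervalIntegrable_min_one_norm_sub hu hw t T)
    rw [(hx s hs).2, (hy s hs).2, hxy, add_sub_add_left_eq_sub]
    refine (norm_integral_sub_integral_le hb hl hs.1 (hxc.mono hsub) (hyc.mono hsub) hu hw
      (hx s hs).1 (hy s hs).1).trans ?_
    gcongr
    linarith
  · rw [mul_right_comm]
    gcongr
    exact hs.2

/-- The cost of a trajectory depends on the control continuously with respect to convergence in
measure. -/
theorem exists_abs_cost_sub_cost_le {Cf Cr : ℝ} {Kf Kr Kq : NNReal}
    (hfb : ∀ x u, ‖f x u‖ ≤ Cf) (hrb : ∀ x u, |r x u| ≤ Cr)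
    (hfl : LipschitzWith Kf
      (fun p : EuclideanSpace ℝ (Fin n) × EuclideanSpace ℝ (Fin m) => f p.1 p.2))
    (hrl : LipschitzWith Kr
      (fun p : EuclideanSpace ℝ (Fin n) × EuclideanSpace ℝ (Fin m) => r p.1 p.2))
    (hql : LipschitzWith Kq q) (htT : t ≤ T) :
    ∃ A : ℝ, 0 ≤ A ∧ ∀ x y u w, IsTrajectory f t T x u → IsTrajectory f t T y w → x t = y t →
      Measurable u → Measurable w →
      |cost r q t T x u - cost r q t T y w| ≤ A * ∫ τ in t..T, min 1 ‖u τ - w τ‖ := by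
  have hCf : 0 ≤ Cf := (norm_nonneg _).trans (hfb 0 0)
  have hCr : 0 ≤ Cr := (abs_nonneg _).trans (hrb 0 0)
  have hT : 0 ≤ T - t := sub_nonneg.2 htT
  set M := (Kf + 2 * Cf) * Real.exp ((Kf + 1) * (T - t)) with hM
  have hM0 : 0 ≤ M := by positivity
  refine ⟨Kr * (M * (T - t)) + (Kr + 2 * Cr) + Kq * M, by positivity, ?_⟩
  intro x y u w hx hy hxy hu hw
  have hxc := hx.continuousOn htT
  have hyc := hy.continuousOn htT
  have hd := hx.norm_sub_le hfb hfl htT hy hxy hu hw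
  rw [← hM] at hd
  set I := ∫ τ in t..T, min 1 ‖u τ - w τ‖ with hI
  have h1 := norm_integral_sub_integral_le hrb hrl htT hxc hyc hu hw
    (intervalIntegrable_running_cost hrb hrl.continuous htT hxc hu)
    (intervalIntegrable_running_cost hrb hrl.continuous htT hyc hw)
  rw [← hI, Real.norm_eq_abs] at h1
  have h2 : ∫ τ in t..T, ‖x τ - y τ‖ ≤ M * I * (T - t) := by
    have := intervalIntegral.integral_mono_on htT
      (ContinuousOn.intervalIntegrable ((hxc.sub hyc).norm.mono (uIcc_of_le htT).le))
      (intervalIntegrable_const (μ := volume) (c := M * I)) hd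
    rwa [intervalIntegral.integral_const, smul_eq_mul, mul_comm (T - t)] at this
  have h3 : |q (x T) - q (y T)| ≤ Kq * (M * I) := by
    have := hql.dist_le_mul (x T) (y T)
    rw [Real.dist_eq, dist_eq_norm] at this
    exact this.trans (by gcongr; exact hd T ⟨htT, le_rfl⟩)
  have h4 : (Kr : ℝ) * ∫ τ in t..T, ‖x τ - y τ‖ ≤ Kr * (M * I * (T - t)) := by gcongr
  unfold cost
  rw [add_sub_add_comm]
  refine (abs_add_le _ _).trans ?_
  linarith

theorem neg_le_cost {Cr Cq : ℝ} (hrb : ∀ x u, |r x u| ≤ Cr) (hqb : ∀ x, |q x| ≤ Cq)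
    (htT : t ≤ T) : -(Cr * (T - t) + Cq) ≤ cost r q t T x u := by
  have h1 : |∫ s in t..T, r (x s) (u s)| ≤ Cr * |T - t| :=
    intervalIntegral.norm_integral_le_of_norm_le_const (f := fun s => r (x s) (u s))
      fun s _ => hrb _ _
  rw [abs_of_nonneg (sub_nonneg.2 htT)] at h1
  unfold cost
  linarith [neg_le_of_abs_le h1, neg_le_of_abs_le (hqb (x T))]

end Trajectories

/-- **Theorem 3 (asymptotic consistency)**: for every `(x, u, t) ∈ ℝⁿ × ℝᵐ × [0, T]`,
`Q⁰(x, u, t) := lim_{ε → 0⁺} Q^ε(x, u, t) = v(x, t)`, the unconstrained value function. -/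
theorem Qeps_tendsto_vfun {n m : ℕ}
    (f : EuclideanSpace ℝ (Fin n) → EuclideanSpace ℝ (Fin m) → EuclideanSpace ℝ (Fin n))
    (r : EuclideanSpace ℝ (Fin n) → EuclideanSpace ℝ (Fin m) → ℝ)
    (q : EuclideanSpace ℝ (Fin n) → ℝ) (T : ℝ)
    (Cf Cr Cq : ℝ)
    (hfb : ∀ x u, ‖f x u‖ ≤ Cf) (hrb : ∀ x u, |r x u| ≤ Cr) (hqb : ∀ x, |q x| ≤ Cq)
    (Kf Kr Kq : NNReal)
    (hfl : LipschitzWith Kf (fun p : EuclideanSpace ℝ (Fin n) × EuclideanSpace ℝ (Fin m) => f p.1 p.2))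
    (hrl : LipschitzWith Kr (fun p : EuclideanSpace ℝ (Fin n) × EuclideanSpace ℝ (Fin m) => r p.1 p.2))
    (hql : LipschitzWith Kq q)
    (x₀ : EuclideanSpace ℝ (Fin n)) (u₀ : EuclideanSpace ℝ (Fin m))
    (t : ℝ) (ht : t ∈ Set.Icc 0 T) :
    Filter.Tendsto (fun ε => Qeps f r q T ε x₀ u₀ t) (𝓝[>] (0 : ℝ))
      (𝓝 (vfun f r q T x₀ t)) := by
  have htT : t ≤ T := ht.2
  have hbddV : BddBelow {c : ℝ | ∃ (x : ℝ → EuclideanSpace ℝ (Fin n))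
      (u : ℝ → EuclideanSpace ℝ (Fin m)),
      Measurable u ∧ IsTrajectory f t T x u ∧ x t = x₀ ∧ c = cost r q t T x u } := by
    refine ⟨-(Cr * (T - t) + Cq), ?_⟩
    rintro c ⟨x, u, -, -, -, rfl⟩
    exact neg_le_cost hrb hqb htT
  have hbddQ : ∀ ε : ℝ, BddBelow {c : ℝ | ∃ x u, Adm (1 / ε) T u ∧ IsTrajectory f t T x u ∧
      x t = x₀ ∧ u t = u₀ ∧ c = cost r q t T x u } := fun ε => by
    refine ⟨-(Cr * (T - t) + Cq), ?_⟩
    rintro c ⟨x, u, -, -, -, -, rfl⟩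
    exact neg_le_cost hrb hqb htT
  obtain ⟨x₁, hx₁, hx₁t⟩ := exists_isTrajectory hfb hfl htT (continuous_const (y := u₀)) x₀
  refine tendsto_order.2 ⟨fun a ha => ?_, fun a ha => ?_⟩
  · refine .of_forall fun ε => ha.trans_le (le_csInf ?_ ?_)
    · exact ⟨_, x₁, fun _ => u₀, (LipschitzWith.const' u₀).lipschitzOnWith, hx₁t, hx₁, rfl, rfl⟩
    · rintro c ⟨x, u, hu, hxu, hx, -, rfl⟩
      have h0T : (0 : ℝ) ≤ T := ht.1.trans ht.2
      have heq : EqOn u (IccExtend h0T ((Icc 0 T).domRestrict u)) (Icc t T) := fun s hs =>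
        (IccExtend_of_mem h0T ((Icc 0 T).domRestrict u) ⟨ht.1.trans hs.1, hs.2⟩).symm
      refine csInf_le hbddV ⟨x, _, ?_, hxu.congr_control heq, hx, cost_congr_control htT heq⟩
      exact (hu.continuousOn.domRestrict.Icc_extend').measurable
  · unfold vfun at ha
    obtain ⟨c, ⟨x, u, hu, hxu, hx, rfl⟩, hc⟩ :=
      exists_lt_of_csInf_lt
        (by exact ⟨_, x₁, fun _ => u₀, measurable_const, hx₁t, hx₁, rfl⟩) ha
    obtain ⟨A, hA, hcost⟩ :=
      exists_abs_cost_sub_cost_le (t := t) (T := T) hfb hrb hfl hrl hql htT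
    obtain ⟨C, w, hwl, hwt, hw⟩ := exists_lipschitzWith_integral_min_one_norm_sub_le hu htT u₀
      (η := (a - cost r q t T x u) / (A + 1)) (div_pos (sub_pos.2 hc) (by positivity))
    obtain ⟨y, hy, hyw⟩ := exists_isTrajectory hfb hfl htT hwl.continuous x₀
    have hlt : cost r q t T y w < a := by
      have h1 := hcost x y u w hxu hyw (hx.trans hy.symm) hu hwl.continuous.measurable
      have h2 : A * ((a - cost r q t T x u) / (A + 1)) < a - cost r q t T x u := by
        rw [mul_div_assoc', div_lt_iff₀ (by positivity)]
        linarith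
      have h3 := mul_le_mul_of_nonneg_left hw hA
      linarith [neg_le_of_abs_le h1]
    have hpos : (0 : ℝ) < 1 / (C + 1) := by positivity
    filter_upwards [Ioo_mem_nhdsGT hpos] with ε hε
    refine (csInf_le (hbddQ ε) ⟨y, w, ?_, hyw, hy, hwt, rfl⟩).trans_lt hlt
    refine (hwl.weaken ?_).lipschitzOnWith
    rw [← NNReal.coe_le_coe, Real.coe_toNNReal _ (one_div_pos.2 hε.1).le]
    have := (lt_one_div (by positivity) hε.1).2 hε.2
    linarith

end
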